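/- arXiv:0805.1596 — 3 statements merged into one kernel-verified Lean document; each statement's English description precedes it below -/
import Mathlib

section
/- Fix $R_0\ge 1$. There exist constants $\Lambda_0>1$, $C>0$ and $(C_k)_{k\ge 1}$ such that for every $\lambda\ge\Lambda_0$ there is a smooth function $f_\lambda:[0,\infty)\to\mathbb{R}$ satisfying: (i) $f_\lambda(r)=0$ for $r\le R_0$; (ii) $f_\lambda(r)=\lambda r$ for $r\ge 2\ln\lambda$; (iii) $0\le f_\lambda(r)\le r f_\lambda'(r)\le 2\lambda r$ for all $r\ge 0$; (iv) $f_\lambda'(r)+|f_\lambda''(r)|\le C(1+f_\lambda(r))$ for all $r\ge 0$; (v) for every $k\ge 1$, $|f_\lambda^{(k)}(r)|\le C_k\lambda$ for all $r\ge 0$. -/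
open Real Finset

theorem iteratedDeriv_smoothTransition_eq_zero {m : ℕ} (hm : m ≠ 0) {t : ℝ}
    (ht : t ≤ 0 ∨ 1 ≤ t) : iteratedDeriv m smoothTransition t = 0 := by
  have hclosed : IsClosed {s : ℝ | iteratedDeriv m smoothTransition s = 0} :=
    isClosed_eq (smoothTransition.contDiff.continuous_iteratedDeriv' m) continuous_const
  have hleft : Set.Iio (0 : ℝ) ⊆ {s : ℝ | iteratedDeriv m smoothTransition s = 0} := by
    intro s hs
    have h : smoothTransition =ᶠ[nhds s] fun _ => (0 : ℝ) := by
      filter_upwards [Iio_mem_nhds hs] with x hx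
      exact smoothTransition.zero_of_nonpos (le_of_lt hx)
    simp [h.iteratedDeriv_eq m]
  have hright : Set.Ioi (1 : ℝ) ⊆ {s : ℝ | iteratedDeriv m smoothTransition s = 0} := by
    intro s hs
    have h : smoothTransition =ᶠ[nhds s] fun _ => (1 : ℝ) := by
      filter_upwards [Ioi_mem_nhds hs] with x hx
      exact smoothTransition.one_of_one_le (le_of_lt hx)
    simp [h.iteratedDeriv_eq m, iteratedDeriv_const, hm]
  rcases ht with ht | ht
  · exact hclosed.closure_subset_iff.2 hleft (by simpa [closure_Iio] using ht)
  · exact hclosed.closure_subset_iff.2 hright (by simpa [closure_Ioi] using ht)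

theorem exists_bound_iteratedDeriv_smoothTransition :
    ∃ K : ℕ → ℝ, ∀ m, 1 ≤ K m ∧ ∀ t, |iteratedDeriv m smoothTransition t| ≤ K m := by
  suffices h : ∀ m : ℕ, ∃ K : ℝ, 1 ≤ K ∧ ∀ t, |iteratedDeriv m smoothTransition t| ≤ K by
    choose K hK using h
    exact ⟨K, hK⟩
  intro m
  rcases eq_or_ne m 0 with rfl | hm
  · refine ⟨1, le_rfl, fun t => ?_⟩
    rw [iteratedDeriv_zero, abs_of_nonneg (smoothTransition.nonneg t)]
    exact smoothTransition.le_one t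
  · obtain ⟨K, hK⟩ := (isCompact_Icc (a := (0 : ℝ)) (b := 1)).exists_bound_of_continuousOn
      (smoothTransition.contDiff.continuous_iteratedDeriv' m).continuousOn
    refine ⟨max K 1, le_max_right _ _, fun t => ?_⟩
    by_cases ht : t ∈ Set.Icc (0 : ℝ) 1
    · exact (hK t ht).trans (le_max_left _ _)
    · rw [iteratedDeriv_smoothTransition_eq_zero hm, abs_zero]
      · positivity
      · by_contra! h
        exact ht ⟨h.1.le, h.2.le⟩

/-- The `m`-th derivative of the staircase `r ↦ ∑ j < N, a j * φ (r - (R + j))`, where `φ` is the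
smooth transition function. -/
noncomputable def staircase (a : ℕ → ℝ) (N : ℕ) (R : ℝ) (m : ℕ) (r : ℝ) : ℝ :=
  ∑ j ∈ range N, a j * iteratedDeriv m smoothTransition (r - (R + j))

section Staircase

variable {a : ℕ → ℝ} {N : ℕ} {R : ℝ}

theorem hasDerivAt_staircase (m : ℕ) (r : ℝ) :
    HasDerivAt (staircase a N R m) (staircase a N R (m + 1) r) r := by
  have hdiff : Differentiable ℝ (iteratedDeriv m smoothTransition) :=
    smoothTransition.contDiff.differentiable_iteratedDeriv m (n := (⊤ : ℕ∞))
      (by exact_mod_cast ENat.natCast_lt_top m)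
  unfold staircase
  refine HasDerivAt.fun_sum fun j _ => HasDerivAt.const_mul _ ?_
  rw [iteratedDeriv_succ]
  exact (hdiff _).hasDerivAt.comp_sub_const r (R + j)

theorem contDiff_staircase_zero : ContDiff ℝ (⊤ : ℕ∞) (staircase a N R 0) := by
  unfold staircase
  simp only [iteratedDeriv_zero]
  fun_prop

theorem iteratedDeriv_mul_staircase (k : ℕ) :
    iteratedDeriv k (fun r => r * staircase a N R 0 r) =
      fun r => r * staircase a N R k r + k * staircase a N R (k - 1) r := by
  induction k with
  | zero => simp
  | succ k ih =>
    rw [iteratedDeriv_succ, ih]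
    funext r
    refine HasDerivAt.deriv ?_
    have h := ((hasDerivAt_id r).mul (hasDerivAt_staircase (a := a) (N := N) (R := R) k r)).add
      ((hasDerivAt_staircase (a := a) (N := N) (R := R) (k - 1) r).const_mul (k : ℝ))
    refine h.congr_deriv ?_
    rcases k with _ | k
    · simp [add_comm]
    · simp only [id_eq, Nat.add_one_sub_one, Nat.cast_add, Nat.cast_one]
      ring

theorem staircase_of_le (m : ℕ) {r : ℝ} (hr : r ≤ R) : staircase a N R m r = 0 := by
  refine sum_eq_zero fun j _ => ?_
  have hj : r - (R + j) ≤ 0 := by linarith [Nat.cast_nonneg (α := ℝ) j]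
  rcases eq_or_ne m 0 with rfl | hm
  · simp [smoothTransition.zero_of_nonpos hj]
  · rw [iteratedDeriv_smoothTransition_eq_zero hm (Or.inl hj), mul_zero]

theorem staircase_zero_of_le {r : ℝ} (hr : R + N ≤ r) :
    staircase a N R 0 r = ∑ j ∈ range N, a j := by
  refine sum_congr rfl fun j hj => ?_
  have hj' : ((j + 1 : ℕ) : ℝ) ≤ N := by exact_mod_cast mem_range.1 hj
  push_cast at hj'
  rw [iteratedDeriv_zero, smoothTransition.one_of_one_le (by linarith), mul_one]

theorem staircase_eq_single {m j : ℕ} (hm : m ≠ 0) {r : ℝ} (h₁ : R + j ≤ r)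
    (h₂ : r < R + j + 1) : staircase a N R m r =
      if j < N then a j * iteratedDeriv m smoothTransition (r - (R + j)) else 0 := by
  unfold staircase
  simp only [← mem_range]
  rw [← sum_ite_eq' (range N) j fun i => a i * iteratedDeriv m smoothTransition (r - (R + i))]
  refine sum_congr rfl fun i _ => ?_
  split_ifs with hij
  · rfl
  · rw [iteratedDeriv_smoothTransition_eq_zero hm, mul_zero]
    rcases Nat.lt_or_gt_of_ne hij with h | h
    · right
      have : ((i + 1 : ℕ) : ℝ) ≤ j := by exact_mod_cast h
      push_cast at this
      linarith
    · left
      have : ((j + 1 : ℕ) : ℝ) ≤ i := by exact_mod_cast h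
      push_cast at this
      linarith

theorem staircase_zero_nonneg (ha : ∀ j, 0 ≤ a j) (r : ℝ) : 0 ≤ staircase a N R 0 r :=
  sum_nonneg fun j _ => mul_nonneg (ha j) (by simpa using smoothTransition.nonneg _)

theorem staircase_zero_le_sum (ha : ∀ j, 0 ≤ a j) (r : ℝ) :
    staircase a N R 0 r ≤ ∑ j ∈ range N, a j :=
  sum_le_sum fun j _ => mul_le_of_le_one_right (ha j) (by simpa using smoothTransition.le_one _)

theorem staircase_one_nonneg (ha : ∀ j, 0 ≤ a j) (r : ℝ) : 0 ≤ staircase a N R 1 r :=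
  sum_nonneg fun j _ => mul_nonneg (ha j) (by
    rw [iteratedDeriv_one]
    exact smoothTransition.monotone.deriv_nonneg)

theorem le_staircase_zero (ha : ∀ j, 0 ≤ a j) {j : ℕ} (hj : j < N) {r : ℝ}
    (hr : R + j + 1 ≤ r) : a j ≤ staircase a N R 0 r := by
  have h := single_le_sum (s := range N)
    (f := fun i : ℕ => a i * iteratedDeriv 0 smoothTransition (r - (R + i)))
    (fun i _ => mul_nonneg (ha i) (by simpa using smoothTransition.nonneg _)) (mem_range.2 hj)
  simpa [staircase, smoothTransition.one_of_one_le (show 1 ≤ r - (R + j) by linarith)] using h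

theorem mul_abs_staircase_le {K : ℕ → ℝ}
    (hK : ∀ m t, |iteratedDeriv m smoothTransition t| ≤ K m) {lam : ℝ} (ha : ∀ j, 0 ≤ a j)
    (hlam : ∀ j : ℕ, a j * (R + j + 1) ≤ lam) (hR : 0 ≤ R) {m : ℕ} (hm : m ≠ 0) (r : ℝ) :
    r * |staircase a N R m r| ≤ K m * lam := by
  have hK₀ : 0 ≤ K m := (abs_nonneg _).trans (hK m 0)
  have hlam₀ : 0 ≤ lam := (mul_nonneg (ha 0) (by simp; linarith)).trans (hlam 0)
  rcases le_total r R with hr | hr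
  · rw [staircase_of_le m hr]
    simpa using mul_nonneg hK₀ hlam₀
  · have h₁ := Nat.floor_le (sub_nonneg.2 hr)
    have h₂ := Nat.lt_floor_add_one (r - R)
    rw [staircase_eq_single hm (j := ⌊r - R⌋₊) (by linarith) (by linarith)]
    split_ifs with hj
    · rw [abs_mul, abs_of_nonneg (ha _)]
      calc r * (a _ * |_|) = (a _ * r) * |_| := by ring
        _ ≤ lam * K m := by
            refine mul_le_mul ?_ (hK m _) (abs_nonneg _) hlam₀
            refine le_trans ?_ (hlam ⌊r - R⌋₊)
            exact mul_le_mul_of_nonneg_left (by linarith) (ha _)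
        _ = K m * lam := mul_comm _ _
    · simpa using mul_nonneg hK₀ hlam₀

theorem mul_abs_staircase_le_growth {K : ℕ → ℝ}
    (hK : ∀ m t, |iteratedDeriv m smoothTransition t| ≤ K m) {B : ℝ} (ha : ∀ j, 0 ≤ a j)
    (ha₀ : a 0 ≤ 1) (hB : ∀ j, a (j + 1) ≤ B * a j) (hB₀ : 0 ≤ B) (hR : 0 ≤ R) {m : ℕ}
    (hm : m ≠ 0) {r : ℝ} (hr₀ : 0 ≤ r) :
    r * |staircase a N R m r| ≤ K m * (R + 1 + B * (r * staircase a N R 0 r)) := by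
  have hK₀ : 0 ≤ K m := (abs_nonneg _).trans (hK m 0)
  have hs := staircase_zero_nonneg (N := N) (R := R) ha r
  have hrhs : 0 ≤ R + 1 + B * (r * staircase a N R 0 r) := by positivity
  rcases le_total r R with hr | hr
  · rw [staircase_of_le m hr]
    simpa using mul_nonneg hK₀ hrhs
  · have h₁ := Nat.floor_le (sub_nonneg.2 hr)
    have h₂ := Nat.lt_floor_add_one (r - R)
    rw [staircase_eq_single hm (j := ⌊r - R⌋₊) (by linarith) (by linarith)]
    generalize ⌊r - R⌋₊ = j at h₁ h₂
    split_ifs with hj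
    · rw [abs_mul, abs_of_nonneg (ha _)]
      calc r * (a j * |_|) = |_| * (r * a j) := by ring
        _ ≤ K m * (R + 1 + B * (r * staircase a N R 0 r)) := by
            refine mul_le_mul (hK m _) ?_ (mul_nonneg hr₀ (ha _)) hK₀
            rcases j with _ | j
            · have : 0 ≤ B * (r * staircase a N R 0 r) := by positivity
              push_cast at h₂
              nlinarith [ha 0]
            · push_cast at h₁
              have h₃ := le_staircase_zero (N := N) (R := R) ha (j := j) (by omega)
                (show R + j + 1 ≤ r by linarith)
              have h₄ := mul_le_mul_of_nonneg_left h₃ hB₀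
              have h₅ := mul_le_mul_of_nonneg_left ((hB j).trans h₄) hr₀
              linarith
    · simpa using mul_nonneg hK₀ hrhs

end Staircase

theorem log_sub_log_le_sum_inv {R : ℝ} (hR : 0 ≤ R) {n N : ℕ} (h : n ≤ N) :
    log (R + N + 1) - log (R + n + 1) ≤ ∑ j ∈ Ico n N, (R + j + 1)⁻¹ := by
  induction N, h using Nat.le_induction with
  | base => simp
  | succ N hN ih =>
    rw [sum_Ico_succ_top hN]
    have hpos : 0 < R + N + 1 := by positivity
    have h : log (R + (N + 1 : ℕ) + 1) - log (R + N + 1) ≤ (R + N + 1)⁻¹ := by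
      rw [← log_div (by positivity) hpos.ne']
      refine (log_le_sub_one_of_pos (by positivity)).trans (le_of_eq ?_)
      push_cast
      field_simp
      ring
    linarith

/-- Weights growing at most geometrically, each at most of harmonic size, with total `lam`. -/
theorem exists_weights {R M : ℝ} (hR : 1 ≤ R) (hM : 1 ≤ M) {lam : ℝ}
    (hlam : exp ((R + 2) * exp M) ≤ lam) :
    ∃ (N : ℕ) (a : ℕ → ℝ), (∀ j, 0 ≤ a j) ∧ R + N ≤ 2 * log lam ∧
      ∑ j ∈ range N, a j = lam ∧ (∀ j : ℕ, M * (a j * (R + j + 1)) ≤ lam) ∧ a 0 ≤ 1 ∧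
      ∀ j, a (j + 1) ≤ exp (exp M) * a j := by
  have hlam₀ : 0 < lam := (exp_pos _).trans_le hlam
  have hlog : (R + 2) * exp M ≤ log lam := (le_log_iff_exp_le hlam₀).2 hlam
  have hexp : 1 ≤ exp M := one_le_exp (by linarith)
  set L := log lam with hL
  have hLR : R + 2 ≤ L := by nlinarith
  set n := ⌈L / exp M⌉₊ with hn
  set N := ⌊2 * L - R⌋₊ with hN
  have hn₁ : L / exp M ≤ n := Nat.le_ceil _
  have hn₂ : (n : ℝ) < L / exp M + 1 := Nat.ceil_lt_add_one (div_nonneg (by linarith) (exp_pos M).le)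
  have hN₁ : (N : ℝ) ≤ 2 * L - R := Nat.floor_le (by linarith)
  have hN₂ : 2 * L - R < N + 1 := Nat.lt_floor_add_one _
  have hLe : R + 2 ≤ L / exp M := by rwa [le_div_iff₀ (exp_pos M)]
  have hratio : exp M * (R + n + 1) ≤ R + N + 1 := by
    have h : exp M * (R + n + 1) ≤ exp M * (2 * (L / exp M)) := by
      gcongr
      linarith
    have h' : exp M * (2 * (L / exp M)) = 2 * L := by field_simp
    linarith
  have hnN : n ≤ N := by
    have : (n : ℝ) ≤ N := by nlinarith [Nat.cast_nonneg (α := ℝ) n]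
    exact_mod_cast this
  have hlogs : M ≤ log (R + N + 1) - log (R + n + 1) := by
    have h := log_le_log (by positivity) hratio
    rw [log_mul (by positivity) (by positivity), log_exp] at h
    linarith
  set B := exp (exp M) with hB
  have hB₁ : 1 ≤ B := one_le_exp (by linarith)
  set b : ℕ → ℝ := fun j => min (B ^ j) (lam / (M * (R + j + 1))) with hb
  have hb₀ : ∀ j, 0 ≤ b j := fun j => le_min (by positivity) (by positivity)
  have hb_succ : ∀ j, b (j + 1) ≤ B * b j := by
    intro j
    simp only [hb]
    rw [mul_min_of_nonneg _ _ (by linarith)]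
    refine min_le_min (pow_succ' B j).le ?_
    refine le_trans ?_ (le_mul_of_one_le_left (by positivity) hB₁)
    gcongr
    simp
  have hBn : lam ≤ B ^ n := by
    rw [hB, ← exp_nat_mul, ← exp_log hlam₀]
    exact exp_le_exp.2 ((div_le_iff₀ (exp_pos M)).1 hn₁)
  have hb_tail : ∀ j ∈ Ico n N, b j = lam / M * (R + j + 1)⁻¹ := by
    intro j hj
    have h₁ : lam / (M * (R + j + 1)) ≤ lam :=
      div_le_self hlam₀.le (one_le_mul_of_one_le_of_one_le hM (by
        linarith [Nat.cast_nonneg (α := ℝ) j]))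
    have h₂ : lam ≤ B ^ j := hBn.trans (pow_le_pow_right₀ hB₁ (mem_Ico.1 hj).1)
    simp only [hb]
    rw [min_eq_right (h₁.trans h₂)]
    field_simp
  have hsum : lam ≤ ∑ j ∈ range N, b j := by
    calc lam = lam / M * M := by field_simp
      _ ≤ lam / M * ∑ j ∈ Ico n N, (R + j + 1)⁻¹ := by
          gcongr
          exact hlogs.trans (log_sub_log_le_sum_inv (by linarith) hnN)
      _ = ∑ j ∈ Ico n N, b j := by rw [mul_sum, sum_congr rfl hb_tail]
      _ ≤ ∑ j ∈ range N, b j :=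
          sum_le_sum_of_subset_of_nonneg (by intro j; simp) fun j _ _ => hb₀ j
  set T := ∑ j ∈ range N, b j with hT
  have hT₀ : 0 < T := hlam₀.trans_le hsum
  have hs₀ : 0 ≤ lam / T := by positivity
  have hs₁ : lam / T ≤ 1 := (div_le_one hT₀).2 hsum
  refine ⟨N, fun j => lam / T * b j, fun j => mul_nonneg hs₀ (hb₀ j), by linarith, ?_, ?_, ?_, ?_⟩
  · rw [← mul_sum, ← hT]
    field_simp
  · intro j
    have hj : 0 < M * (R + j + 1) := by positivity
    have h := (mul_le_of_le_one_left (hb₀ j) hs₁).trans (min_le_right (B ^ j) _)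
    rw [le_div_iff₀ hj] at h
    linarith
  · refine (mul_le_of_le_one_left (hb₀ 0) hs₁).trans ((min_le_left _ _).trans ?_)
    simp
  · intro j
    have := mul_le_mul_of_nonneg_left (hb_succ j) hs₀
    linarith


/-- existence of the escape-function profiles `f_λ` (Lemma 5.1): smooth,
vanishing on `[0, R₀]`, equal to `λ r` for `r ≥ 2 ln λ`, convex-type bounds
`0 ≤ f_λ ≤ r f_λ' ≤ 2λr`, `f_λ' + |f_λ''| = O(1 + f_λ)`, and `f_λ^{(k)} = O(λ)`,
with all constants independent of `λ`. -/
theorem exists_escape_function (R₀ : ℝ) (hR₀ : 1 ≤ R₀) :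
    ∃ (Λ₀ C : ℝ) (Ck : ℕ → ℝ), 1 < Λ₀ ∧ 0 < C ∧
      ∀ lam : ℝ, Λ₀ ≤ lam →
        ∃ f : ℝ → ℝ, ContDiff ℝ (⊤ : ℕ∞) f ∧
          (∀ r : ℝ, 0 ≤ r → r ≤ R₀ → f r = 0) ∧
          (∀ r : ℝ, 2 * Real.log lam ≤ r → f r = lam * r) ∧
          (∀ r : ℝ, 0 ≤ r →
            0 ≤ f r ∧ f r ≤ r * deriv f r ∧ r * deriv f r ≤ 2 * lam * r) ∧
          (∀ r : ℝ, 0 ≤ r → deriv f r + |iteratedDeriv 2 f r| ≤ C * (1 + f r)) ∧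
          (∀ k : ℕ, 1 ≤ k → ∀ r : ℝ, 0 ≤ r → |iteratedDeriv k f r| ≤ Ck k * lam) := by
  obtain ⟨K, hK'⟩ := exists_bound_iteratedDeriv_smoothTransition
  have hK₁ : ∀ m, 1 ≤ K m := fun m => (hK' m).1
  have hK : ∀ m t, |iteratedDeriv m smoothTransition t| ≤ K m := fun m => (hK' m).2
  set B := exp (exp (K 1)) with hB
  have hB₀ : 0 ≤ B := (exp_pos _).le
  have hR : 0 ≤ R₀ := by linarith
  refine ⟨exp ((R₀ + 2) * exp (K 1)), 1 + (3 * K 1 + K 2) * (R₀ + 1 + B),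
    fun k => K k + k * K (k - 1), ?_, ?_, fun lam hlam => ?_⟩
  · exact one_lt_exp_iff.2 (by positivity)
  · have := hK₁ 1
    have := hK₁ 2
    positivity
  obtain ⟨N, a, ha, hN, hsum, hharm, ha₀, hgrowth⟩ := exists_weights hR₀ (hK₁ 1) hlam
  have hlam₀ : 0 < lam := (exp_pos _).trans_le hlam
  have hharm' : ∀ j : ℕ, a j * (R₀ + j + 1) ≤ lam := fun j =>
    (le_mul_of_one_le_left (mul_nonneg (ha j) (by positivity)) (hK₁ 1)).trans (hharm j)
  have hsmall : ∀ m ≠ 0, ∀ r, r * |staircase a N R₀ m r| ≤ K m * lam := fun m hm r =>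
    mul_abs_staircase_le hK ha hharm' hR hm r
  have hgrow : ∀ m ≠ 0, ∀ r, 0 ≤ r →
      r * |staircase a N R₀ m r| ≤ K m * (R₀ + 1 + B * (r * staircase a N R₀ 0 r)) :=
    fun m hm r hr => mul_abs_staircase_le_growth hK ha ha₀ hgrowth hB₀ hR hm hr
  have habs : ∀ m r, |staircase a N R₀ m r| ≤ r * |staircase a N R₀ m r| := by
    intro m r
    rcases le_total r R₀ with hr | hr
    · simp [staircase_of_le m hr]
    · exact le_mul_of_one_le_left (abs_nonneg _) (hR₀.trans hr)
  have hg₀ := staircase_zero_nonneg (N := N) (R := R₀) ha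
  have hg₁ := staircase_one_nonneg (N := N) (R := R₀) ha
  have hg_le : ∀ r, staircase a N R₀ 0 r ≤ lam := fun r =>
    (staircase_zero_le_sum ha r).trans hsum.le
  have hslope : ∀ r, r * staircase a N R₀ 1 r ≤ lam := by
    intro r
    have h := mul_abs_staircase_le (a := fun j => K 1 * a j) (N := N) (R := R₀) hK
      (fun j => mul_nonneg (by linarith [hK₁ 1]) (ha j))
      (fun j => by rw [mul_assoc]; exact hharm j) hR one_ne_zero r
    have heq : staircase (fun j => K 1 * a j) N R₀ 1 r = K 1 * staircase a N R₀ 1 r := by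
      simp only [staircase, mul_sum, mul_assoc]
    have hK₀ : 0 < K 1 := by linarith [hK₁ 1]
    rw [heq, abs_of_nonneg (mul_nonneg hK₀.le (hg₁ r)), mul_left_comm] at h
    exact le_of_mul_le_mul_left h hK₀
  have hderiv : ∀ r, deriv (fun r => r * staircase a N R₀ 0 r) r =
      r * staircase a N R₀ 1 r + staircase a N R₀ 0 r := by
    intro r
    rw [← iteratedDeriv_one, iteratedDeriv_mul_staircase]
    simp
  refine ⟨fun r => r * staircase a N R₀ 0 r, contDiff_id.mul contDiff_staircase_zero,
    fun r _ hr => ?_, fun r hr => ?_, fun r hr => ⟨mul_nonneg hr (hg₀ r), ?_, ?_⟩,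
    fun r hr => ?_, fun k hk r hr => ?_⟩
  · simp [staircase_of_le 0 hr]
  · simp only
    rw [staircase_zero_of_le (hN.trans hr), hsum, mul_comm]
  · rw [hderiv]
    exact mul_le_mul_of_nonneg_left (le_add_of_nonneg_left (mul_nonneg hr (hg₁ r))) hr
  · rw [hderiv, mul_comm]
    exact mul_le_mul_of_nonneg_right (by linarith [hslope r, hg_le r]) hr
  · rw [hderiv, iteratedDeriv_mul_staircase]
    simp only [Nat.add_one_sub_one, Nat.cast_ofNat]
    set s := r * staircase a N R₀ 0 r with hs
    have hs₀ : 0 ≤ s := mul_nonneg hr (hg₀ r)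
    have h₀ := habs 0 r
    rw [abs_of_nonneg (hg₀ r)] at h₀
    have h₁ := hgrow 1 one_ne_zero r hr
    have h₁' := habs 1 r
    rw [abs_of_nonneg (hg₁ r)] at h₁ h₁'
    have h₂ := hgrow 2 two_ne_zero r hr
    have h₃ : |r * staircase a N R₀ 2 r + 2 * staircase a N R₀ 1 r| ≤
        r * |staircase a N R₀ 2 r| + 2 * staircase a N R₀ 1 r := by
      refine (abs_add_le _ _).trans (le_of_eq ?_)
      rw [abs_mul, abs_of_nonneg hr, abs_of_nonneg (mul_nonneg zero_le_two (hg₁ r))]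
    have h₄ : R₀ + 1 + B * s ≤ (R₀ + 1 + B) * (1 + s) := by nlinarith
    have h₅ : 0 ≤ 3 * K 1 + K 2 := by linarith [hK₁ 1, hK₁ 2]
    have h₆ := mul_le_mul_of_nonneg_left h₄ h₅
    nlinarith
  · rw [iteratedDeriv_mul_staircase]
    have hlow : |staircase a N R₀ (k - 1) r| ≤ K (k - 1) * lam := by
      rcases eq_or_ne (k - 1) 0 with h | h
      · rw [h, abs_of_nonneg (hg₀ r)]
        exact (hg_le r).trans (le_mul_of_one_le_left hlam₀.le (hK₁ 0))
      · exact (habs _ r).trans (hsmall _ h r)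
    calc |r * staircase a N R₀ k r + k * staircase a N R₀ (k - 1) r|
        ≤ r * |staircase a N R₀ k r| + k * |staircase a N R₀ (k - 1) r| := by
          refine (abs_add_le _ _).trans (le_of_eq ?_)
          rw [abs_mul, abs_mul, abs_of_nonneg hr, Nat.abs_cast]
      _ ≤ K k * lam + k * (K (k - 1) * lam) := by
          exact add_le_add (hsmall k (by omega) r)
            (mul_le_mul_of_nonneg_left hlow (Nat.cast_nonneg k))
      _ = (K k + k * K (k - 1)) * lam := by ring
end

section
/- Let $F$ be a real symmetric $n\times n$ matrix and let $\theta>0$. Then the complex matrix $I+i\theta F$ is invertible, and for every $\xi\in\mathbb{R}^n$, $\mathrm{Im}\big[((I+i\theta F)^{-1}\xi)\cdot((I+i\theta F)^{-1}\xi)\big]=-2\theta\,\big\langle F\,(I+\theta^2F^2)^{-2}\xi,\ \xi\big\rangle$, where $u\cdot v=\sum_{j=1}^n u_jv_j$ denotes the bilinear (non-conjugated) dot product on $\mathbb{C}^n$ and $\langle\cdot,\cdot\rangle$ the real Euclidean inner product. -/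
open Matrix

theorem Matrix.IsSymm.isUnit_one_add_sq_smul_mul_self {n : Type*} [Fintype n] [DecidableEq n]
    {F : Matrix n n ℝ} (hF : F.IsSymm) (θ : ℝ) :
    IsUnit (1 + (θ ^ 2) • (F * F)) := by
  have hsq : (θ ^ 2) • (F * F) = (θ • F)ᴴ * (θ • F) := by
    simp [conjTranspose_eq_transpose_of_trivial, hF.eq, smul_smul, sq]
  rw [hsq]
  exact (PosDef.one.add_posSemidef (posSemidef_conjTranspose_mul_self _)).isUnit

/-- The inverse of `I + iθF` is the product of its conjugate and the real matrix
`(I + θ²F²)⁻¹`. -/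
theorem Matrix.IsSymm.one_add_I_smul_mul_eq_one {n : Type*} [Fintype n] [DecidableEq n]
    {F : Matrix n n ℝ} (hF : F.IsSymm) (θ : ℝ) :
    ((1 : Matrix n n ℂ) + (θ : ℂ) • Complex.I • F.map ((↑) : ℝ → ℂ)) *
      ((1 - (θ : ℂ) • Complex.I • F.map ((↑) : ℝ → ℂ)) *
        ((1 + (θ ^ 2) • (F * F))⁻¹).map ((↑) : ℝ → ℂ)) = 1 := by
  have hmul (A B : Matrix n n ℝ) : (A * B).map ((↑) : ℝ → ℂ) = A.map (↑) * B.map (↑) :=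
    Matrix.map_mul (f := Complex.ofRealHom)
  have hG : ((1 : Matrix n n ℂ) + (θ : ℂ) • Complex.I • F.map ((↑) : ℝ → ℂ)) *
      (1 - (θ : ℂ) • Complex.I • F.map ((↑) : ℝ → ℂ)) =
      (1 + (θ ^ 2) • (F * F)).map ((↑) : ℝ → ℂ) := by
    have hmap : (1 + (θ ^ 2) • (F * F)).map ((↑) : ℝ → ℂ) =
        1 + ((θ : ℂ) ^ 2) • (F.map (↑) * F.map (↑)) := by
      rw [← hmul]
      ext i j
      by_cases h : i = j <;> simp [h]
    have hI : (θ : ℂ) * Complex.I * (θ * Complex.I) = -(θ : ℂ) ^ 2 := by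
      linear_combination (θ : ℂ) ^ 2 * Complex.I_mul_I
    rw [hmap, smul_smul, add_mul, mul_sub, mul_sub, smul_mul_smul_comm, hI, neg_smul, one_mul,
      one_mul, mul_one]
    abel
  rw [← mul_assoc, hG, ← hmul, mul_nonsing_inv _
    ((isUnit_iff_isUnit_det _).1 (hF.isUnit_one_add_sq_smul_mul_self θ))]
  ext i j
  by_cases h : i = j <;> simp [h, one_apply]

/-- for a real symmetric matrix `F` and `θ > 0`, the matrix `I + iθF` is
invertible and
`Im[((I+iθF)⁻¹ξ)·((I+iθF)⁻¹ξ)] = -2θ ⟨F (I+θ²F²)⁻² ξ, ξ⟩` for real vectors `ξ`. -/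
theorem im_distorted_quadratic_form (n : ℕ) (F : Matrix (Fin n) (Fin n) ℝ)
    (hF : F.IsSymm) (θ : ℝ) (hθ : 0 < θ) :
    IsUnit ((1 : Matrix (Fin n) (Fin n) ℂ) + (θ : ℂ) • Complex.I • F.map ((↑) : ℝ → ℂ)) ∧
    ∀ ξ : Fin n → ℝ,
      ((((1 : Matrix (Fin n) (Fin n) ℂ) + (θ : ℂ) • Complex.I • F.map ((↑) : ℝ → ℂ))⁻¹
            *ᵥ fun j => (ξ j : ℂ)) ⬝ᵥ
          (((1 : Matrix (Fin n) (Fin n) ℂ) + (θ : ℂ) • Complex.I • F.map ((↑) : ℝ → ℂ))⁻¹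
            *ᵥ fun j => (ξ j : ℂ))).im =
        -2 * θ * (((F * ((1 + (θ ^ 2) • (F * F))⁻¹ ^ 2)) *ᵥ ξ) ⬝ᵥ ξ) := by
  have hinv := hF.one_add_I_smul_mul_eq_one θ
  refine ⟨IsUnit.of_mul_eq_one _ hinv, fun ξ => ?_⟩
  rw [inv_eq_right_inv hinv]
  set G := 1 + (θ ^ 2) • (F * F) with hG
  have hGsymm : (G⁻¹)ᵀ = G⁻¹ := by
    rw [transpose_nonsing_inv]
    simp [hG, hF.eq]
  have hcomm : G⁻¹ * F = F * G⁻¹ := by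
    have hFG : Commute F G :=
      (Commute.one_right F).add_right (((Commute.refl F).mul_right (Commute.refl F)).smul_right _)
    have hdet := (isUnit_iff_isUnit_det _).1 (hF.isUnit_one_add_sq_smul_mul_self θ)
    calc G⁻¹ * F = G⁻¹ * (F * G) * G⁻¹ := by
          rw [mul_assoc, mul_nonsing_inv_cancel_right _ _ hdet]
      _ = F * G⁻¹ := by rw [hFG.eq, nonsing_inv_mul_cancel_left _ _ hdet]
  have hvec (A : Matrix (Fin n) (Fin n) ℝ) (v : Fin n → ℝ) :
      (A.map ((↑) : ℝ → ℂ) *ᵥ fun j => (v j : ℂ)) = fun j => (((A *ᵥ v) j : ℝ) : ℂ) := by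
    ext j
    simp [mulVec, dotProduct]
  rw [← mulVec_mulVec, hvec, sub_mulVec, one_mulVec, smul_mulVec, smul_mulVec, hvec]
  have hre : ((F * G⁻¹ ^ 2) *ᵥ ξ) ⬝ᵥ ξ = (G⁻¹ *ᵥ ξ) ⬝ᵥ (F *ᵥ (G⁻¹ *ᵥ ξ)) := by
    rw [sq, ← mul_assoc, ← hcomm, mul_assoc, ← mulVec_mulVec, ← mulVec_mulVec,
      dotProduct_comm, dotProduct_mulVec, ← mulVec_transpose, hGsymm]
  rw [hre]
  simp only [dotProduct, Complex.im_sum, Finset.mul_sum]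
  refine Finset.sum_congr rfl fun j _ => ?_
  simp
  ring
end

section
/- Let $R_0\ge 1$, let $b:[0,\infty)\to\mathbb{R}$ be smooth with $b=0$ on $[0,R_0]$ and $0\le b(r)\le r\,b'(r)\le 2r$ for all $r\ge 0$, set $a(r):=b(r)/r$, $A(x):=a(|x|)x$, and for $\theta>0$ let $\Phi_\theta(x):=x+i\theta A(x)$. Then there exists $\theta_0>0$ (independent of $b$ and $n$) such that for all $0<\theta\le\theta_0$ and all $x,\xi\in\mathbb{R}^n$, $\mathrm{Im}\big[(({}^t d\Phi_\theta(x))^{-1}\xi)\cdot(({}^t d\Phi_\theta(x))^{-1}\xi)\big]\le-\theta\,a(|x|)\,|\xi|^2$. -/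
open Matrix

/-- The radial distortion field `A(x) = (b(|x|)/|x|) x`. -/
noncomputable def distField (n : ℕ) (b : ℝ → ℝ) (x : EuclideanSpace ℝ (Fin n)) :
    EuclideanSpace ℝ (Fin n) := (b ‖x‖ / ‖x‖) • x

/-- The complex matrix `ᵗdΦ_θ(x) = I + iθ dA(x)`, where `dA(x)` is the (symmetric)
Jacobian matrix of the distortion field `A`. -/
noncomputable def distMatrix (n : ℕ) (b : ℝ → ℝ) (θ : ℝ)
    (x : EuclideanSpace ℝ (Fin n)) : Matrix (Fin n) (Fin n) ℂ :=
  (1 : Matrix (Fin n) (Fin n) ℂ) + (θ : ℂ) • Complex.I •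
    (Matrix.of fun i j =>
      fderiv ℝ (distField n b) x (EuclideanSpace.single j (1 : ℝ)) i).map ((↑) : ℝ → ℂ)

theorem hasFDerivAt_distField {n : ℕ} {b : ℝ → ℝ} {x : EuclideanSpace ℝ (Fin n)} (hx : x ≠ 0)
    (hb : DifferentiableAt ℝ b ‖x‖) :
    HasFDerivAt (distField n b)
      ((b ‖x‖ / ‖x‖) • ContinuousLinearMap.id ℝ (EuclideanSpace ℝ (Fin n)) +
        (((deriv b ‖x‖ * ‖x‖ - b ‖x‖) / ‖x‖ ^ 2) • ‖x‖⁻¹ • innerSL ℝ x).smulRight x) x := by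
  have hr : ‖x‖ ≠ 0 := norm_ne_zero_iff.mpr hx
  have hnorm : HasFDerivAt (fun y : EuclideanSpace ℝ (Fin n) => ‖y‖) (‖x‖⁻¹ • innerSL ℝ x) x := by
    have h := (hasStrictFDerivAt_norm_sq x).hasFDerivAt.sqrt (pow_ne_zero 2 hr)
    simp only [Real.sqrt_sq (norm_nonneg _)] at h
    have hL : (1 / (2 * ‖x‖)) • 2 • innerSL ℝ x = ‖x‖⁻¹ • innerSL ℝ x := by
      rw [← Nat.cast_smul_eq_nsmul ℝ, smul_smul]
      congr 1
      push_cast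
      field_simp
    rwa [hL] at h
  have hquot : HasDerivAt (fun r => b r / r)
      ((deriv b ‖x‖ * ‖x‖ - b ‖x‖) / ‖x‖ ^ 2) ‖x‖ := by
    simpa using hb.hasDerivAt.fun_div (hasDerivAt_id' ‖x‖) hr
  exact (hquot.comp_hasFDerivAt x hnorm).smul (hasFDerivAt_id x)

/-- On the line `ℂ e` and its complement, `1 + z (a + c e eᵗ)` acts as multiplication by
`1 + z (a + c)` and `1 + z a` respectively. -/
theorem one_add_smul_vecMulVec_mul_eq_one {n : ℕ} {e : Fin n → ℂ} (he : e ⬝ᵥ e = 1)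
    {z a c α γ : ℂ} (hα : α * (1 + z * a) = 1) (hγ : γ * (1 + z * (a + c)) = 1) :
    (1 + z • (a • (1 : Matrix (Fin n) (Fin n) ℂ) + c • vecMulVec e e)) *
      (α • (1 : Matrix (Fin n) (Fin n) ℂ) + (γ - α) • vecMulVec e e) = 1 := by
  have hP : vecMulVec e e * vecMulVec e e = vecMulVec e e := by
    rw [vecMulVec_mul_vecMulVec, he, one_smul]
  simp only [add_mul, mul_add, smul_mul_assoc, mul_smul_comm, hP, one_mul, mul_one, smul_add]
  generalize vecMulVec e e = P
  ext i j
  simp only [Matrix.add_apply, Matrix.smul_apply, smul_eq_mul]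
  linear_combination (1 : Matrix (Fin n) (Fin n) ℂ) i j * hα + P i j * (hγ - hα)

theorem dotProduct_smul_one_add_smul_vecMulVec_mulVec {n : ℕ} {e : Fin n → ℂ} (he : e ⬝ᵥ e = 1)
    (α γ : ℂ) (v : Fin n → ℂ) :
    ((α • (1 : Matrix (Fin n) (Fin n) ℂ) + (γ - α) • vecMulVec e e) *ᵥ v) ⬝ᵥ
      ((α • (1 : Matrix (Fin n) (Fin n) ℂ) + (γ - α) • vecMulVec e e) *ᵥ v) =
      α ^ 2 * (v ⬝ᵥ v - (e ⬝ᵥ v) ^ 2) + γ ^ 2 * (e ⬝ᵥ v) ^ 2 := by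
  have hv : (α • (1 : Matrix (Fin n) (Fin n) ℂ) + (γ - α) • vecMulVec e e) *ᵥ v =
      α • v + ((γ - α) * (e ⬝ᵥ v)) • e := by
    rw [add_mulVec, smul_mulVec, smul_mulVec, one_mulVec, vecMulVec_mulVec]
    ext i
    simp
    ring
  rw [hv]
  simp only [add_dotProduct, dotProduct_add, smul_dotProduct, dotProduct_smul, he,
    dotProduct_comm v e, smul_eq_mul]
  ring

theorem one_add_ofReal_mul_I_mul_ne_zero (θ t : ℝ) : (1 + θ * Complex.I * t : ℂ) ≠ 0 := by
  intro h
  simpa using congrArg Complex.re h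

theorem im_inv_one_add_sq_le {θ t a : ℝ} (hθ : 0 < θ) (hθ' : θ ≤ 1 / 4) (ha : 0 ≤ a)
    (hat : a ≤ t) (ht : t ≤ 2) :
    (((1 + θ * Complex.I * t : ℂ)⁻¹) ^ 2).im ≤ -θ * a := by
  have hpos : 0 < 1 + (θ * t) ^ 2 := by positivity
  have him : (((1 + θ * Complex.I * t : ℂ)⁻¹) ^ 2).im = -(2 * θ * t) / (1 + (θ * t) ^ 2) ^ 2 := by
    have hN : Complex.normSq (1 + θ * Complex.I * t : ℂ) = 1 + (θ * t) ^ 2 := by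
      simp [Complex.normSq_apply]
      ring
    rw [sq, Complex.mul_im, Complex.inv_re, Complex.inv_im, hN]
    simp
    field_simp
    ring
  have hs : θ * t ≤ 1 / 2 := by nlinarith
  have hs0 : 0 ≤ θ * t := mul_nonneg hθ.le (ha.trans hat)
  have hden : (1 + (θ * t) ^ 2) ^ 2 ≤ 2 := by
    have : (θ * t) ^ 2 ≤ 1 / 4 := by nlinarith
    nlinarith [sq_nonneg (θ * t)]
  rw [him, div_le_iff₀ (by positivity)]
  have h1 : θ * a ≤ θ * t := mul_le_mul_of_nonneg_left hat hθ.le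
  have h2 : 0 ≤ θ * a := mul_nonneg hθ.le ha
  nlinarith

theorem distMatrix_zero {n : ℕ} {b : ℝ → ℝ} {R : ℝ} (hR : 0 < R)
    (hb : ∀ r ∈ Set.Icc (0 : ℝ) R, b r = 0) (θ : ℝ) : distMatrix n b θ 0 = 1 := by
  have h : distField n b =ᶠ[nhds 0] fun _ => 0 := by
    filter_upwards [Metric.ball_mem_nhds (0 : EuclideanSpace ℝ (Fin n)) hR] with y hy
    rw [mem_ball_zero_iff] at hy
    simp [distField, hb ‖y‖ ⟨norm_nonneg y, hy.le⟩]
  have h0 : fderiv ℝ (distField n b) 0 = 0 := by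
    rw [h.fderiv_eq]
    simp
  ext i j
  simp [distMatrix, h0]

theorem distMatrix_eq {n : ℕ} {b : ℝ → ℝ} {x : EuclideanSpace ℝ (Fin n)} (hx : x ≠ 0)
    (hb : DifferentiableAt ℝ b ‖x‖) (θ : ℝ) :
    distMatrix n b θ x = 1 + (θ * Complex.I) • (((b ‖x‖ / ‖x‖ : ℝ) : ℂ) •
      (1 : Matrix (Fin n) (Fin n) ℂ) + ((deriv b ‖x‖ - b ‖x‖ / ‖x‖ : ℝ) : ℂ) •
        vecMulVec (fun j => ((x j / ‖x‖ : ℝ) : ℂ)) (fun j => ((x j / ‖x‖ : ℝ) : ℂ))) := by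
  have hr : (‖x‖ : ℂ) ≠ 0 := by exact_mod_cast norm_ne_zero_iff.mpr hx
  ext i j
  have hone : ((1 : Matrix (Fin n) (Fin n) ℂ) i j) =
      (((EuclideanSpace.single j (1 : ℝ) : EuclideanSpace ℝ (Fin n)) i : ℝ) : ℂ) := by
    simp [Matrix.one_apply, apply_ite ((↑) : ℝ → ℂ)]
  simp only [distMatrix, (hasFDerivAt_distField hx hb).fderiv, Matrix.add_apply,
    Matrix.smul_apply, Matrix.map_apply, Matrix.of_apply, vecMulVec_apply, smul_eq_mul, hone]
  simp only [PiLp.single_apply]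
  split_ifs with h
  · simp [EuclideanSpace.inner_single_right, h]
    field_simp
  · simp [EuclideanSpace.inner_single_right, h]
    field_simp

/-- Lemma A.1: with the distortion `Φ_θ(x) = x + iθ A(x)`,
`A(x) = a(|x|)x`, `a(r) = b(r)/r`, one has
`Im[((ᵗdΦ_θ(x))⁻¹ξ)·((ᵗdΦ_θ(x))⁻¹ξ)] ≤ -θ a(|x|)|ξ|²` for all `θ ∈ (0, θ₀]`,
where `θ₀ > 0` is independent of `b` and of the dimension `n`. -/
theorem distorted_laplacian_quadratic_form :
    ∃ θ₀ : ℝ, 0 < θ₀ ∧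
      ∀ (n : ℕ) (R₀ : ℝ), 1 ≤ R₀ →
      ∀ b : ℝ → ℝ, ContDiff ℝ (⊤ : ℕ∞) b →
        (∀ r : ℝ, r ∈ Set.Icc (0 : ℝ) R₀ → b r = 0) →
        (∀ r : ℝ, 0 ≤ r → 0 ≤ b r ∧ b r ≤ r * deriv b r ∧ r * deriv b r ≤ 2 * r) →
        ∀ θ : ℝ, 0 < θ → θ ≤ θ₀ →
        ∀ x ξ : EuclideanSpace ℝ (Fin n),
          IsUnit (distMatrix n b θ x) ∧
          (((distMatrix n b θ x)⁻¹ *ᵥ fun j => (ξ j : ℂ)) ⬝ᵥ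
              ((distMatrix n b θ x)⁻¹ *ᵥ fun j => (ξ j : ℂ))).im ≤
            -θ * (b ‖x‖ / ‖x‖) * ‖ξ‖ ^ 2 := by
  refine ⟨1 / 4, by norm_num, ?_⟩
  intro n R₀ hR b hb hb0 hbd θ hθ hθ' x ξ
  have hξ : (fun j => (ξ j : ℂ)) ⬝ᵥ (fun j => (ξ j : ℂ)) = ((‖ξ‖ ^ 2 : ℝ) : ℂ) := by
    rw [EuclideanSpace.real_norm_sq_eq]
    simp [dotProduct, sq]
  rcases eq_or_ne x 0 with rfl | hx
  · rw [distMatrix_zero (by linarith) hb0]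
    refine ⟨isUnit_one, ?_⟩
    rw [inv_one, one_mulVec, hξ, Complex.ofReal_im]
    simp
  have hr : 0 < ‖x‖ := norm_pos_iff.mpr hx
  obtain ⟨h0, h1, h2⟩ := hbd ‖x‖ hr.le
  have hM := distMatrix_eq hx ((hb.differentiable (by simp)) ‖x‖) θ
  have ha0 : 0 ≤ b ‖x‖ / ‖x‖ := by positivity
  have hab : b ‖x‖ / ‖x‖ ≤ deriv b ‖x‖ := by
    rw [div_le_iff₀ hr]
    linarith
  have hb2 : deriv b ‖x‖ ≤ 2 := by nlinarith
  set a := b ‖x‖ / ‖x‖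
  set t := deriv b ‖x‖
  set e : Fin n → ℂ := fun j => ((x j / ‖x‖ : ℝ) : ℂ) with he_def
  have he : e ⬝ᵥ e = 1 := by
    have h : ∑ j, x j / ‖x‖ * (x j / ‖x‖) = 1 := by
      have hsum := EuclideanSpace.real_norm_sq_eq x
      simp_rw [div_mul_div_comm, ← sq, ← Finset.sum_div, ← hsum]
      field_simp
    simp only [dotProduct, he_def]
    exact_mod_cast h
  obtain ⟨s, hs, hsξ⟩ : ∃ s : ℝ, e ⬝ᵥ (fun j => (ξ j : ℂ)) = s ∧ s ^ 2 ≤ ‖ξ‖ ^ 2 := by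
    refine ⟨∑ j, x j / ‖x‖ * ξ j, by simp [dotProduct, he_def], ?_⟩
    have hin : ∑ j, x j / ‖x‖ * ξ j = inner ℝ x ξ / ‖x‖ := by
      simp only [PiLp.inner_apply, Finset.sum_div]
      refine Finset.sum_congr rfl fun j _ => ?_
      simp
      ring
    rw [hin, ← sq_abs, abs_div, abs_norm]
    gcongr
    rw [div_le_iff₀ hr, mul_comm]
    exact abs_real_inner_le_norm x ξ
  have hinv := one_add_smul_vecMulVec_mul_eq_one he (z := θ * Complex.I) (a := a)
    (c := ((t - a : ℝ) : ℂ)) (inv_mul_cancel₀ (one_add_ofReal_mul_I_mul_ne_zero θ a))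
    (γ := (1 + θ * Complex.I * t)⁻¹) (by
      rw [← Complex.ofReal_add, add_sub_cancel]
      exact inv_mul_cancel₀ (one_add_ofReal_mul_I_mul_ne_zero θ t))
  rw [← hM] at hinv
  refine ⟨IsUnit.of_mul_eq_one _ hinv, ?_⟩
  rw [Matrix.inv_eq_right_inv hinv, dotProduct_smul_one_add_smul_vecMulVec_mulVec he, hξ, hs,
    ← Complex.ofReal_pow, ← Complex.ofReal_sub, Complex.add_im, Complex.im_mul_ofReal,
    Complex.im_mul_ofReal]
  have hα := im_inv_one_add_sq_le hθ hθ' ha0 le_rfl (hab.trans hb2)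
  have hγ := im_inv_one_add_sq_le hθ hθ' ha0 hab hb2
  calc _ ≤ -θ * a * (‖ξ‖ ^ 2 - s ^ 2) + -θ * a * s ^ 2 :=
        add_le_add (mul_le_mul_of_nonneg_right hα (sub_nonneg.mpr hsξ))
          (mul_le_mul_of_nonneg_right hγ (sq_nonneg s))
    _ = _ := by ring
end
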